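/- Let Σ be a finite alphabet, let S ∈ Σ^∞, and let T = S[0]S[0…1]S[0…2]S[0…3]… be the sequence obtained by concatenating every prefix of S in order of increasing length. Then dim_FS(S) ≤ dim_FS(T). -/

import Mathlib

/-- Number of sliding-block occurrences of `w` in `s`:
`N(w,s) = |{i : s[i…i+|w|−1] = w}|`. -/
def slideN {α : Type*} [DecidableEq α] (w s : List α) : ℕ :=
  ((Finset.range (s.length + 1 - w.length)).filter
    (fun i => ((s.drop i).take w.length) = w)).card

/-- Sliding count probability of `w` in `s`: `P(w,s) = N(w,s)/(|s|−|w|+1)`. -/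
noncomputable def slideP {α : Type*} [DecidableEq α] (w s : List α) : ℝ :=
  (slideN w s : ℝ) / ((s.length : ℝ) - (w.length : ℝ) + 1)

/-- `l`-th sliding block entropy of a string, with logarithms base `|α|`.
The convention `0 · log(1/0) = 0` holds automatically since `Real.logb b 0⁻¹ = 0`. -/
noncomputable def slideH {α : Type*} [Fintype α] [DecidableEq α] (l : ℕ) (x : List α) : ℝ :=
  (1 / (l : ℝ)) * ∑ w : Fin l → α,
    slideP (List.ofFn w) x * Real.logb (Fintype.card α) (slideP (List.ofFn w) x)⁻¹

/-- The prefix `S[0…n]` of a sequence, i.e. its first `n+1` symbols. -/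
def pre {α : Type*} (S : ℕ → α) (n : ℕ) : List α := List.ofFn (fun i : Fin (n + 1) => S i)

/-- Finite-state dimension via sliding block entropies:
`dim_FS(S) = inf_{l ≥ 1} liminf_{n→∞} H_l(S[0…n])`. -/
noncomputable def dimFS {α : Type*} [Fintype α] [DecidableEq α] (S : ℕ → α) : ℝ :=
  ⨅ l : ℕ, Filter.liminf (fun n => slideH (l + 1) (pre S n)) Filter.atTop

/-- Finite-state strong dimension:
`Dim_FS(S) = inf_{l ≥ 1} limsup_{n→∞} H_l(S[0…n])`. -/
noncomputable def DimFS {α : Type*} [Fintype α] [DecidableEq α] (S : ℕ → α) : ℝ :=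
  ⨅ l : ℕ, Filter.limsup (fun n => slideH (l + 1) (pre S n)) Filter.atTop
/-- Cumulative lengths of a sequence of lists. -/
def cumLen {α : Type*} (L : ℕ → List α) : ℕ → ℕ
  | 0 => 0
  | m + 1 => cumLen L m + (L m).length

open scoped Classical in
/-- The infinite sequence obtained by concatenating the lists `L 0, L 1, L 2, …`
(a default symbol is used in the degenerate case where the total length is finite). -/
noncomputable def concatSeq {α : Type*} (dflt : α) (L : ℕ → List α) (k : ℕ) : α :=
  if h : ∃ m, k < cumLen L (m + 1) then
    (L (Nat.find h)).getD (k - cumLen L (Nat.find h)) dflt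
  else dflt

open Filter Finset Topology Real

section BlockAverages

variable {W : Type*} [DecidableEq W]

/-- Number of `k < n` with `u k = w`. -/
noncomputable def symbolCount (u : ℕ → W) (w : W) (n : ℕ) : ℝ :=
  ∑ k ∈ range n, if u k = w then 1 else 0

lemma symbolCount_nonneg (u : ℕ → W) (w : W) (n : ℕ) : 0 ≤ symbolCount u w n :=
  sum_nonneg fun _ _ => by split_ifs <;> norm_num

lemma symbolCount_le (u : ℕ → W) (w : W) (n : ℕ) : symbolCount u w n ≤ n := by
  calc symbolCount u w n ≤ ∑ _k ∈ range n, (1 : ℝ) :=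
        sum_le_sum fun _ _ => by split_ifs <;> norm_num
    _ = n := by simp

lemma symbolCount_div_mem_Icc (u : ℕ → W) (w : W) (n : ℕ) :
    symbolCount u w n / n ∈ Set.Icc (0 : ℝ) 1 :=
  ⟨div_nonneg (symbolCount_nonneg u w n) n.cast_nonneg,
    div_le_one_of_le₀ (symbolCount_le u w n) n.cast_nonneg⟩

lemma symbolCount_add (u : ℕ → W) (w : W) (m n : ℕ) :
    symbolCount u w (m + n) = symbolCount u w m + symbolCount (fun k => u (m + k)) w n :=
  sum_range_add _ _ _

/-- Two sequences agreeing on the first `q` places have counts over `r ≤ q + l` places which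
differ by at most `l`. -/
lemma abs_symbolCount_sub_le {u v : ℕ → W} {l q r : ℕ} (h : ∀ j < q, v j = u j)
    (hr : r ≤ q + l) (w : W) : |symbolCount v w r - symbolCount u w r| ≤ l := by
  rw [symbolCount, symbolCount, ← sum_sub_distrib]
  calc |∑ k ∈ range r, ((if v k = w then (1 : ℝ) else 0) - if u k = w then 1 else 0)|
      ≤ ∑ k ∈ range r, |(if v k = w then (1 : ℝ) else 0) - if u k = w then 1 else 0| :=
        abs_sum_le_sum_abs _ _
    _ ≤ ∑ k ∈ range r, if q ≤ k then (1 : ℝ) else 0 := by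
        refine sum_le_sum fun k _ => ?_
        by_cases hk : q ≤ k
        · rw [if_pos hk]
          split_ifs <;> norm_num
        · simp [h k (not_le.mp hk), hk]
    _ = ((#{k ∈ range r | q ≤ k} : ℕ) : ℝ) := by simp
    _ ≤ l := by
        have : {k ∈ range r | q ≤ k} ⊆ Ico q (q + l) := fun k hk => by
          simp only [mem_filter, Finset.mem_range, Finset.mem_Ico] at hk ⊢
          omega
        exact_mod_cast (card_le_card this).trans (by simp)

/-- The sum of the lengths of the first `m` blocks, the `i`-th of which has length `i + 1`. -/
def blockStart (m : ℕ) : ℕ := ∑ i ∈ range m, (i + 1)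

lemma blockStart_succ (m : ℕ) : blockStart (m + 1) = blockStart m + (m + 1) :=
  sum_range_succ _ _

lemma sq_le_two_mul_blockStart (m : ℕ) : m ^ 2 ≤ 2 * blockStart m := by
  induction m with
  | zero => simp
  | succ m ih => rw [blockStart_succ]; nlinarith

lemma exists_eq_blockStart_add (n : ℕ) : ∃ m r, n = blockStart m + r ∧ r ≤ m := by
  induction n with
  | zero => exact ⟨0, 0, by simp [blockStart], le_rfl⟩
  | succ n ih =>
    obtain ⟨m, r, rfl, hr⟩ := ih
    rcases hr.lt_or_eq with h | rfl
    · exact ⟨m, r + 1, by ring, h⟩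
    · exact ⟨r + 1, 0, by rw [blockStart_succ]; ring, by omega⟩

lemma abs_symbolCount_blockStart_sub_le {u v : ℕ → W} {l : ℕ}
    (h : ∀ m j, j + l ≤ m + 1 → v (blockStart m + j) = u j) (w : W) (m : ℕ) :
    |symbolCount v w (blockStart m) - ∑ i ∈ range m, symbolCount u w (i + 1)| ≤ l * m := by
  induction m with
  | zero => simp [blockStart, symbolCount]
  | succ m ih =>
    rw [blockStart_succ, symbolCount_add, sum_range_succ]
    have hb : |symbolCount (fun k => v (blockStart m + k)) w (m + 1) - symbolCount u w (m + 1)|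
        ≤ l :=
      abs_symbolCount_sub_le (q := m + 1 - l) (fun j hj => h m j (by omega)) (by omega) w
    rw [abs_le] at ih hb ⊢
    push_cast
    constructor <;> linarith [ih.1, ih.2, hb.1, hb.2]

lemma abs_symbolCount_blockStart_add_sub_le {u v : ℕ → W} {l : ℕ}
    (h : ∀ m j, j + l ≤ m + 1 → v (blockStart m + j) = u j) (w : W) {m r : ℕ} (hr : r ≤ m) :
    |symbolCount v w (blockStart m + r)
      - (∑ i ∈ range m, symbolCount u w (i + 1) + symbolCount u w r)| ≤ l * (m + 1) := by
  have ih := abs_symbolCount_blockStart_sub_le h w m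
  have hb : |symbolCount (fun k => v (blockStart m + k)) w r - symbolCount u w r| ≤ l :=
    abs_symbolCount_sub_le (q := m + 1 - l) (fun j hj => h m j (by omega)) (by omega) w
  rw [symbolCount_add]
  rw [abs_le] at ih hb ⊢
  constructor <;> linarith [ih.1, ih.2, hb.1, hb.2]

lemma tendsto_succ_div_of_sq_le {m : ℕ → ℕ} (h : ∀ n, m n ^ 2 ≤ 2 * n) :
    Tendsto (fun n : ℕ => ((m n : ℝ) + 1) / n) atTop (𝓝 0) := by
  have hs : Tendsto (fun n : ℕ => √(n : ℝ)) atTop atTop :=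
    tendsto_sqrt_atTop.comp tendsto_natCast_atTop_atTop
  refine squeeze_zero (fun n => by positivity) (fun n => ?_)
    (Tendsto.const_div_atTop hs (3 : ℝ))
  rcases Nat.eq_zero_or_pos n with rfl | hn
  · simp
  have hn1 : (1 : ℝ) ≤ n := by exact_mod_cast hn
  have hq : √(n : ℝ) ^ 2 = n := sq_sqrt n.cast_nonneg
  have hq1 : 1 ≤ √(n : ℝ) := one_le_sqrt.mpr hn1
  have hm : (m n : ℝ) ^ 2 ≤ 2 * n := by exact_mod_cast h n
  have hm2 : (m n : ℝ) ≤ 2 * √(n : ℝ) := by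
    refine abs_le_of_sq_le_sq' ?_ (by positivity) |>.2
    rw [mul_pow, hq]; linarith
  rw [div_le_div_iff₀ (by linarith) (by linarith)]
  nlinarith

lemma tendsto_negMulLog_sub {p q : ℕ → ℝ} (hp : ∀ n, p n ∈ Set.Icc (0 : ℝ) 1)
    (hq : ∀ n, q n ∈ Set.Icc (0 : ℝ) 1) (h : Tendsto (fun n => p n - q n) atTop (𝓝 0)) :
    Tendsto (fun n => negMulLog (p n) - negMulLog (q n)) atTop (𝓝 0) := by
  have hu := isCompact_Icc.uniformContinuousOn_of_continuous
    (continuous_negMulLog.continuousOn (s := Set.Icc (0 : ℝ) 1))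
  rw [Metric.uniformContinuousOn_iff] at hu
  rw [Metric.tendsto_nhds] at h ⊢
  intro ε hε
  obtain ⟨δ, hδ, hd⟩ := hu ε hε
  filter_upwards [h δ hδ] with n hn
  have := hd (p n) (hp n) (q n) (hq n) (by simpa [Real.dist_eq] using hn)
  simpa [Real.dist_eq] using this

variable [Fintype W]

/-- Natural-logarithm entropy of the empirical distribution of the first `n` terms of `u`. -/
noncomputable def empiricalEntropy (u : ℕ → W) (n : ℕ) : ℝ :=
  ∑ w, negMulLog (symbolCount u w n / n)

lemma empiricalEntropy_nonneg (u : ℕ → W) (n : ℕ) : 0 ≤ empiricalEntropy u n :=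
  sum_nonneg fun w _ => negMulLog_nonneg (symbolCount_div_mem_Icc u w n).1
    (symbolCount_div_mem_Icc u w n).2

lemma negMulLog_le_one {x : ℝ} (hx : 0 ≤ x) : negMulLog x ≤ 1 := by
  rcases hx.eq_or_lt with rfl | hx
  · simp
  have h := mul_le_mul_of_nonneg_left (one_sub_inv_le_log_of_pos hx) hx.le
  rw [mul_sub, mul_inv_cancel₀ hx.ne'] at h
  rw [negMulLog]
  linarith

lemma empiricalEntropy_le (u : ℕ → W) (n : ℕ) : empiricalEntropy u n ≤ Fintype.card W := by
  calc empiricalEntropy u n ≤ ∑ _w : W, (1 : ℝ) :=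
        sum_le_sum fun w _ => negMulLog_le_one (symbolCount_div_mem_Icc u w n).1
    _ = Fintype.card W := by simp

/-- Concavity: the entropy of a mixture of empirical distributions is at least the mixture of
the entropies. -/
lemma sum_mul_empiricalEntropy_le {ι : Type*} (u : ℕ → W) (s : Finset ι) (len : ι → ℕ) {n : ℕ}
    (hn : 0 < n) (hs : ∑ i ∈ s, len i = n) :
    (∑ i ∈ s, len i * empiricalEntropy u (len i)) / n
      ≤ ∑ w, negMulLog ((∑ i ∈ s, symbolCount u w (len i)) / n) := by
  have hn' : (0 : ℝ) < n := by exact_mod_cast hn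
  have key : ∀ w, ∑ i ∈ s, (len i / n : ℝ) * negMulLog (symbolCount u w (len i) / len i)
      ≤ negMulLog ((∑ i ∈ s, symbolCount u w (len i)) / n) := by
    intro w
    have h := concaveOn_negMulLog.le_map_sum (t := s) (w := fun i => (len i / n : ℝ))
      (p := fun i => symbolCount u w (len i) / len i) (fun i _ => by positivity)
      (by rw [← sum_div, ← Nat.cast_sum, hs, div_self hn'.ne'])
      (fun i _ => (symbolCount_div_mem_Icc u w _).1)
    simp only [smul_eq_mul] at h
    refine h.trans_eq (congrArg _ ?_)
    rw [sum_div]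
    refine sum_congr rfl fun i _ => ?_
    rcases Nat.eq_zero_or_pos (len i) with h0 | h0
    · simp [h0, symbolCount]
    · have : (len i : ℝ) ≠ 0 := by exact_mod_cast h0.ne'
      field_simp
  refine le_trans (le_of_eq ?_) (sum_le_sum fun w _ => key w)
  rw [sum_comm, sum_div]
  refine sum_congr rfl fun i _ => ?_
  rw [← mul_sum, empiricalEntropy]
  ring

/-- If `v` is, up to boundary effects, the concatenation of all prefixes of `u`, then asymptotic
lower bounds for the empirical entropy of `u` carry over to `v`. -/
lemma eventually_sub_le_empiricalEntropy {u v : ℕ → W} {l : ℕ}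
    (h : ∀ m j, j + l ≤ m + 1 → v (blockStart m + j) = u j) {a ε : ℝ} (hε : 0 < ε)
    (ha : ∀ᶠ n in atTop, a ≤ empiricalEntropy u n) :
    ∀ᶠ n in atTop, a - ε ≤ empiricalEntropy v n := by
  choose m r hmr hr using exists_eq_blockStart_add
  have hm : Tendsto (fun n : ℕ => ((m n : ℝ) + 1) / n) atTop (𝓝 0) :=
    tendsto_succ_div_of_sq_le fun n => by
      have := sq_le_two_mul_blockStart (m n)
      have := hmr n
      omega
  set len : ℕ → ℕ → ℕ := fun n i => if i < m n then i + 1 else r n with hlen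
  have split : ∀ (n : ℕ) {M : Type} [AddCommMonoid M] (F : ℕ → M),
      ∑ i ∈ range (m n + 1), F (len n i) = ∑ i ∈ range (m n), F (i + 1) + F (r n) := by
    intro n M _ F
    rw [sum_range_succ]
    congr 1
    · exact sum_congr rfl fun i hi => by simp [hlen, Finset.mem_range.mp hi]
    · simp [hlen]
  have hsum : ∀ n, ∑ i ∈ range (m n + 1), len n i = n := fun n =>
    (split n id).trans (hmr n).symm
  set q : W → ℕ → ℝ := fun w n => (∑ i ∈ range (m n + 1), symbolCount u w (len n i)) / n with hq
  have hq_mem : ∀ w n, q w n ∈ Set.Icc (0 : ℝ) 1 := by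
    refine fun w n => ⟨div_nonneg (sum_nonneg fun _ _ => symbolCount_nonneg _ _ _) n.cast_nonneg,
      div_le_one_of_le₀ ?_ n.cast_nonneg⟩
    calc ∑ i ∈ range (m n + 1), symbolCount u w (len n i)
        ≤ ∑ i ∈ range (m n + 1), (len n i : ℝ) := sum_le_sum fun _ _ => symbolCount_le _ _ _
      _ = n := by rw [← Nat.cast_sum, hsum]
  have hdiff : ∀ w, Tendsto (fun n : ℕ => symbolCount v w n / n - q w n) atTop (𝓝 0) := by
    intro w
    refine squeeze_zero_norm (fun n => ?_) (by simpa using hm.const_mul (l : ℝ))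
    have hb := abs_symbolCount_blockStart_add_sub_le h w (hr n)
    rw [← hmr n, ← split n (symbolCount u w)] at hb
    rw [hq, ← sub_div, Real.norm_eq_abs, abs_div, Nat.abs_cast, mul_div_assoc']
    gcongr
  have hent : Tendsto (fun n => empiricalEntropy v n - ∑ w, negMulLog (q w n)) atTop (𝓝 0) := by
    simp only [empiricalEntropy, ← sum_sub_distrib]
    simpa using tendsto_finsetSum univ fun w _ =>
      tendsto_negMulLog_sub (symbolCount_div_mem_Icc v w) (hq_mem w) (hdiff w)
  obtain ⟨N, hN⟩ := eventually_atTop.mp ha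
  have hlow : ∀ k : ℕ, a * k - |a| * N ≤ k * empiricalEntropy u k := by
    intro k
    rcases le_total N k with hk | hk
    · nlinarith [hN k hk, abs_nonneg a, (k.cast_nonneg : (0 : ℝ) ≤ k),
        mul_nonneg (abs_nonneg a) (N.cast_nonneg : (0 : ℝ) ≤ N)]
    · have h1 : a * k ≤ |a| * N := by
        have : (k : ℝ) ≤ N := by exact_mod_cast hk
        gcongr
        exact le_abs_self a
      have := mul_nonneg (k.cast_nonneg : (0 : ℝ) ≤ k) (empiricalEntropy_nonneg u k)
      linarith
  have hmix : ∀ n > 0, a - |a| * N * ((m n + 1) / n) ≤ ∑ w, negMulLog (q w n) := by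
    intro n hn
    have hn' : (0 : ℝ) < n := by exact_mod_cast hn
    refine le_trans ?_ (sum_mul_empiricalEntropy_le u _ (len n) hn (hsum n))
    rw [le_div_iff₀ hn']
    refine le_trans (le_of_eq ?_) (sum_le_sum fun i _ => hlow (len n i))
    rw [sum_sub_distrib, ← mul_sum, ← Nat.cast_sum, hsum]
    simp only [sum_const, card_range, nsmul_eq_mul]
    push_cast
    field_simp
  have herr := (hm.const_mul (|a| * N)).sub hent
  simp only [mul_zero, sub_zero] at herr
  filter_upwards [herr.eventually (gt_mem_nhds hε), eventually_gt_atTop 0] with n h1 h2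
  linarith [hmix n h2]

end BlockAverages

section SlidingBlocks

variable {α : Type*}

lemma length_pre (S : ℕ → α) (n : ℕ) : (pre S n).length = n + 1 := by simp [pre]

lemma cumLen_pre (S : ℕ → α) (m : ℕ) : cumLen (fun i => pre S i) m = blockStart m := by
  induction m with
  | zero => rfl
  | succ m ih => rw [cumLen, ih, blockStart_succ, length_pre]

lemma monotone_blockStart : Monotone blockStart :=
  monotone_nat_of_le_succ fun m => by rw [blockStart_succ]; omega

lemma concatSeq_pre (d : α) (S : ℕ → α) {m j : ℕ} (hj : j ≤ m) :
    concatSeq d (fun i => pre S i) (blockStart m + j) = S j := by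
  classical
  have hlt : blockStart m + j < cumLen (fun i => pre S i) (m + 1) := by
    rw [cumLen_pre, blockStart_succ]; omega
  have hex : ∃ m', blockStart m + j < cumLen (fun i => pre S i) (m' + 1) := ⟨m, hlt⟩
  have hfind : Nat.find hex = m := by
    rw [Nat.find_eq_iff]
    refine ⟨hlt, fun i hi => ?_⟩
    rw [cumLen_pre]
    have := monotone_blockStart (Nat.succ_le_of_lt hi)
    simp only [Nat.succ_eq_add_one] at this
    omega
  have hval : concatSeq d (fun i => pre S i) (blockStart m + j) =
      (pre S (Nat.find hex)).getD
        (blockStart m + j - cumLen (fun i => pre S i) (Nat.find hex)) d := by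
    rw [concatSeq, dif_pos hex]
  rw [hval, hfind, cumLen_pre, Nat.add_sub_cancel_left,
    List.getD_eq_getElem _ _ (by rw [length_pre]; omega)]
  simp [pre, -List.ofFn_succ]

/-- The sequence of length-`l` windows of `S`. -/
def windows (l : ℕ) (S : ℕ → α) (k : ℕ) : Fin l → α := fun i => S (k + i)

lemma windows_concatSeq_pre (d : α) (S : ℕ → α) {l m j : ℕ} (h : j + l ≤ m + 1) :
    windows l (concatSeq d fun i => pre S i) (blockStart m + j) = windows l S j := by
  funext i
  have := i.isLt
  rw [windows, windows, add_assoc, concatSeq_pre d S (by omega)]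

lemma take_drop_pre (S : ℕ → α) {l n k : ℕ} (h : k + l ≤ n + 1) :
    ((pre S n).drop k).take l = List.ofFn (windows l S k) := by
  apply List.ext_getElem
  · simp [pre]; omega
  · intro i h1 h2
    simp [pre, windows, -List.ofFn_succ]

variable [DecidableEq α]

lemma slideP_pre (S : ℕ → α) (l n : ℕ) (w : Fin (l + 1) → α) :
    slideP (List.ofFn w) (pre S (n + l)) =
      symbolCount (windows (l + 1) S) w (n + 1) / (n + 1 : ℕ) := by
  rw [slideP, slideN, symbolCount, length_pre, List.length_ofFn]
  congr 1
  · rw [sum_boole, show n + l + 1 + 1 - (l + 1) = n + 1 by omega]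
    congr 2
    refine filter_congr fun k hk => ?_
    rw [take_drop_pre S (by have := Finset.mem_range.mp hk; omega), List.ofFn_inj]
  · push_cast; ring

variable [Fintype α]

lemma slideH_pre (S : ℕ → α) (l n : ℕ) :
    slideH (l + 1) (pre S (n + l)) =
      1 / ((l + 1 : ℕ) * log (Fintype.card α)) *
        empiricalEntropy (windows (l + 1) S) (n + 1) := by
  rw [slideH, empiricalEntropy, mul_sum, mul_sum]
  refine sum_congr rfl fun w _ => ?_
  rw [slideP_pre, logb, log_inv, negMulLog]
  simp only [div_eq_mul_inv, mul_inv]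
  ring

end SlidingBlocks

/-- For any sequence `S`, the sequence
`T = S[0]S[0…1]S[0…2]S[0…3]…` obtained by concatenating every prefix of `S` in order
of increasing length satisfies `dim_FS(S) ≤ dim_FS(T)`. -/
theorem stmt5 {α : Type*} [Fintype α] [DecidableEq α] [Inhabited α]
    (hα : 2 ≤ Fintype.card α) (S : ℕ → α) :
    dimFS S ≤ dimFS (concatSeq default (fun i => pre S i)) := by
  have hlog : 0 < log (Fintype.card α) := log_pos (by exact_mod_cast hα)
  have hc : ∀ l : ℕ, 0 < 1 / ((l + 1 : ℕ) * log (Fintype.card α)) := fun l => by positivity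
  have hshift : ∀ (R : ℕ → α) (l : ℕ),
      liminf (fun n => slideH (l + 1) (pre R n)) atTop =
        liminf (fun n => 1 / ((l + 1 : ℕ) * log (Fintype.card α)) *
          empiricalEntropy (windows (l + 1) R) (n + 1)) atTop := fun R l => by
    rw [← liminf_nat_add _ l]
    simp only [slideH_pre]
  have hbdd : ∀ (R : ℕ → α) (l : ℕ), IsBoundedUnder (· ≥ ·) atTop (fun n =>
      1 / ((l + 1 : ℕ) * log (Fintype.card α)) *
        empiricalEntropy (windows (l + 1) R) (n + 1)) := fun R l =>
    isBoundedUnder_of ⟨0, fun n => mul_nonneg (hc l).le (empiricalEntropy_nonneg _ _)⟩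
  have hcobdd : ∀ (R : ℕ → α) (l : ℕ), IsCoboundedUnder (· ≥ ·) atTop (fun n =>
      1 / ((l + 1 : ℕ) * log (Fintype.card α)) *
        empiricalEntropy (windows (l + 1) R) (n + 1)) := fun R l =>
    IsBoundedUnder.isCoboundedUnder_ge (isBoundedUnder_of
      ⟨_, fun n => mul_le_mul_of_nonneg_left (empiricalEntropy_le _ _) (hc l).le⟩)
  refine ciInf_mono ⟨0, ?_⟩ fun l => ?_
  · rintro _ ⟨l, rfl⟩
    simp only [hshift]
    exact le_liminf_of_le (hcobdd S l)
      (Eventually.of_forall fun n => mul_nonneg (hc l).le (empiricalEntropy_nonneg _ _))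
  · rw [hshift, hshift]
    refine le_of_forall_lt_imp_le_of_dense fun a ha => ?_
    refine le_of_forall_pos_le_add fun ε hε => ?_
    rw [← sub_le_iff_le_add]
    refine le_liminf_of_le (hcobdd _ l) ?_
    have hS := eventually_lt_of_lt_liminf ha (hbdd S l)
    set c := 1 / ((l + 1 : ℕ) * log (Fintype.card α)) with hc_def
    have hcl : 0 < c := hc l
    have hu : ∀ᶠ n in atTop, a / c ≤ empiricalEntropy (windows (l + 1) S) n := by
      rw [← map_add_atTop_eq_nat 1, eventually_map]
      filter_upwards [hS] with n hn
      rw [div_le_iff₀' hcl]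
      exact hn.le
    have hv := eventually_sub_le_empiricalEntropy (ε := ε / c)
      (fun _ _ => windows_concatSeq_pre default S) (by positivity) hu
    filter_upwards [(tendsto_add_atTop_nat 1).eventually hv] with n hn
    rw [← sub_div, div_le_iff₀' hcl] at hn
    exact hn
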